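/- (Composition Lemma) For every interpretation I, mechanisms γ1, γ2, and e-predicates P, R, Q: if I ⊨ {P}γ1{R} and I ⊨ {R}γ2{Q}, then I ⊨ {P}γ1;γ2{Q}. -/

import Mathlib

open scoped Classical

noncomputable section

namespace MPL

/-- Terms over variables `V` and function symbols `F` (function symbols applied to
a stream of arguments; finite arities are modelled by ignoring superfluous arguments). -/
inductive Term (V F : Type) : Type where
  | var : V → Term V F
  | app : F → (ℕ → Term V F) → Term V F

/-- Boolean expressions over variables `V`, function symbols `F` and relation symbols `R`. -/
inductive BExp (V F R : Type) : Type where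
  | tt : BExp V F R
  | rel : R → (ℕ → Term V F) → BExp V F R
  | not : BExp V F R → BExp V F R
  | and : BExp V F R → BExp V F R → BExp V F R

/-- MPL mechanisms: assignment, sequential composition, conditional, while-loop,
and simultaneous choice `ch_A(X)` for a finite nonempty set `A` of agents with
distinct choice variables `X a` for `a ∈ A`. -/
inductive Mech (Ag V F R : Type) : Type where
  | assign : V → Term V F → Mech Ag V F R
  | seq : Mech Ag V F R → Mech Ag V F R → Mech Ag V F R
  | ite : BExp V F R → Mech Ag V F R → Mech Ag V F R → Mech Ag V F R
  | wh : BExp V F R → Mech Ag V F R → Mech Ag V F R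
  | choice : (A : Finset Ag) → A.Nonempty → (X : Ag → V) → Set.InjOn X ↑A → Mech Ag V F R

/-- An interpretation: a domain, interpretations of the function and relation symbols,
and for every agent a preference preorder on the domain with a uniformly worst element. -/
structure Interp (Ag V F R : Type) : Type 1 where
  D : Type
  funI : F → (ℕ → D) → D
  relI : R → (ℕ → D) → Prop
  /-- `pref a d d'` means `d ≥_a d'`. -/
  pref : Ag → D → D → Prop
  pref_refl : ∀ a d, pref a d d
  pref_trans : ∀ a d1 d2 d3, pref a d1 d2 → pref a d2 d3 → pref a d1 d3
  worst : D
  worst_least : ∀ a d, pref a d worst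

variable {Ag V F R : Type}

/-- A state assigns a domain element to every mechanism variable. -/
abbrev State (I : Interp Ag V F R) : Type := V → I.D

/-- Value of a term in an interpretation at a state. -/
def Term.eval (I : Interp Ag V F R) (s : State I) : Term V F → I.D
  | .var x => s x
  | .app f ts => I.funI f (fun n => (ts n).eval I s)

/-- Truth of a boolean expression in an interpretation at a state. -/
def BExp.holds (I : Interp Ag V F R) (s : State I) : BExp V F R → Prop
  | .tt => True
  | .rel r ts => I.relI r (fun n => (ts n).eval I s)
  | .not b => ¬ b.holds I s
  | .and b1 b2 => b1.holds I s ∧ b2.holds I s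

/-- A configuration: a mechanism (or `none` for the empty mechanism Λ) together with a state. -/
abbrev Cfg (I : Interp Ag V F R) : Type := Option (Mech Ag V F R) × State I

/-- Update a state at one variable. -/
def updState (I : Interp Ag V F R) (s : State I) (x : V) (d : I.D) : State I :=
  fun y => if y = x then d else s y

/-- The structured operational semantics: labelled transitions `⟨γ,s⟩ →_A ⟨γ',s'⟩`. -/
inductive Step (I : Interp Ag V F R) : Cfg I → Set Ag → Cfg I → Prop where
  | assign (x : V) (t : Term V F) (s : State I) :
      Step I (some (.assign x t), s) ∅ (none, updState I s x (t.eval I s))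
  | choice (A : Finset Ag) (hA : A.Nonempty) (X : Ag → V) (hX : Set.InjOn X ↑A)
      (s s' : State I) (hagree : ∀ y : V, (∀ a ∈ A, X a ≠ y) → s' y = s y) :
      Step I (some (.choice A hA X hX), s) ↑A (none, s')
  | seqFin {γ1 γ2 s L s'} : Step I (some γ1, s) L (none, s') →
      Step I (some (.seq γ1 γ2), s) L (some γ2, s')
  | seqStep {γ1 γ2 s L γ1' s'} : Step I (some γ1, s) L (some γ1', s') →
      Step I (some (.seq γ1 γ2), s) L (some (.seq γ1' γ2), s')
  | iteT {B γ1 γ2 s} : B.holds I s → Step I (some (.ite B γ1 γ2), s) ∅ (some γ1, s)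
  | iteF {B γ1 γ2 s} : ¬ B.holds I s → Step I (some (.ite B γ1 γ2), s) ∅ (some γ2, s)
  | whF {B γ s} : ¬ B.holds I s → Step I (some (.wh B γ), s) ∅ (none, s)
  | whT {B γ s} : B.holds I s → Step I (some (.wh B γ), s) ∅ (some (.seq γ (.wh B γ)), s)

/-- A (partial) history of the game rooted at `c0`: a nonempty finite sequence of
configurations starting at `c0` and linked by transitions. -/
def IsHist (I : Interp Ag V F R) (c0 : Cfg I) (h : List (Cfg I)) : Prop :=
  h.head? = some c0 ∧ h.Chain' (fun c c' => ∃ L, Step I c L c')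

/-- A strategy profile: for every agent a strategy assigning a chosen value to each history. -/
abbrev Profile (I : Interp Ag V F R) : Type := Ag → List (Cfg I) → I.D

/-- The state resulting from the agents in `A` choosing values for their variables
`X a` according to the profile `σ` at history `h`. -/
def chooseVal (I : Interp Ag V F R) (A : Finset Ag) (X : Ag → V) (σ : Profile I)
    (h : List (Cfg I)) (s : State I) : State I :=
  fun y => if hy : ∃ a, a ∈ A ∧ X a = y then σ hy.choose h else s y

/-- The successor configuration of a (non-empty) configuration, as determined by the
operational semantics together with the choices prescribed by the profile `σ` at history `h`. -/
def next (I : Interp Ag V F R) (σ : Profile I) (h : List (Cfg I)) :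
    Mech Ag V F R → State I → Cfg I
  | .assign x t, s => (none, updState I s x (t.eval I s))
  | .choice A _ X _, s => (none, chooseVal I A X σ h s)
  | .seq γ1 γ2, s =>
      match next I σ h γ1 s with
      | (none, s') => (some γ2, s')
      | (some γ1', s') => (some (.seq γ1' γ2), s')
  | .ite B γ1 γ2, s => if B.holds I s then (some γ1, s) else (some γ2, s)
  | .wh B γ, s => if B.holds I s then (some (.seq γ (.wh B γ)), s) else (none, s)

/-- Extend a history by one step of play according to `σ` (histories ending in Λ stay put). -/
def extend (I : Interp Ag V F R) (σ : Profile I) (h : List (Cfg I)) : List (Cfg I) :=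
  match h.getLast? with
  | some (some γ, s) => h ++ [next I σ h γ s]
  | _ => h

/-- The history of the unique run determined by profile `σ` from `c0`, after `n` steps. -/
def runH (I : Interp Ag V F R) (c0 : Cfg I) (σ : Profile I) : ℕ → List (Cfg I)
  | 0 => [c0]
  | n + 1 => extend I σ (runH I c0 σ n)

/-- A run: the (possibly infinite) sequence of configurations of a maximal play. -/
abbrev Run (I : Interp Ag V F R) : Type := ℕ → Option (Cfg I)

/-- The unique maximal run determined by profile `σ` from initial configuration `c0`. -/
def runOf (I : Interp Ag V F R) (c0 : Cfg I) (σ : Profile I) : Run I :=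
  fun n => (runH I c0 σ n)[n]?

/-- `run(σ)` is finite (reaches the empty mechanism Λ). -/
def Terminates (I : Interp Ag V F R) (c0 : Cfg I) (σ : Profile I) : Prop :=
  ∃ n, ∃ s : State I, (runH I c0 σ n).getLast? = some ((none : Option (Mech Ag V F R)), s)

/-- The final state `s_σ` of a finite run. -/
def finalState (I : Interp Ag V F R) {c0 : Cfg I} {σ : Profile I}
    (h : Terminates I c0 σ) : State I :=
  h.choose_spec.choose

/-- An outcome function assigns an element of the domain to every terminal history
(represented by the corresponding run). -/
abbrev OutcomeF (I : Interp Ag V F R) : Type := Run I → I.D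

/-- An extended predicate (e-predicate): a set of pairs (state, outcome). -/
abbrev EPred (I : Interp Ag V F R) : Type := Set (State I × I.D)

/-- `ô ∈ Ô_Q`: every finite run is assigned an outcome satisfying `Q` at its final state. -/
def memOhat (I : Interp Ag V F R) (c0 : Cfg I) (Q : EPred I) (oh : OutcomeF I) : Prop :=
  ∀ σ : Profile I, ∀ ht : Terminates I c0 σ, (finalState I ht, oh (runOf I c0 σ)) ∈ Q

/-- `σ` is a Nash equilibrium in the game rooted at `c0` with outcome function `oh`. -/
def NashEq (I : Interp Ag V F R) (c0 : Cfg I) (oh : OutcomeF I) (σ : Profile I) : Prop :=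
  ∀ (i : Ag) (τ : Profile I), (∀ j, j ≠ i → τ j = σ j) →
    I.pref i (oh (runOf I c0 σ)) (oh (runOf I c0 τ))

/-- Prepend a finite sequence of configurations to a run. -/
def prependRun (I : Interp Ag V F R) (l : List (Cfg I)) (ρ : Run I) : Run I :=
  fun n => if hn : n < l.length then some l[n] else ρ (n - l.length)

/-- Restriction of an outcome function to the subgame reached via history `h`. -/
def restrictO (I : Interp Ag V F R) (h : List (Cfg I)) (oh : OutcomeF I) : OutcomeF I :=
  fun ρ => oh (prependRun I h.dropLast ρ)

/-- Restriction of a strategy profile to the subgame reached via history `h`. -/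
def restrictP (I : Interp Ag V F R) (h : List (Cfg I)) (σ : Profile I) : Profile I :=
  fun a h' => σ a (h.dropLast ++ h')

/-- `σ` is a subgame-perfect equilibrium in `G(γ,s,I,oh)`: its restriction to every
subgame (rooted at any configuration reachable from `⟨γ,s⟩`) is a Nash equilibrium there. -/
def SPE (I : Interp Ag V F R) (γ : Mech Ag V F R) (s : State I)
    (oh : OutcomeF I) (σ : Profile I) : Prop :=
  ∀ (h : List (Cfg I)) (c : Cfg I), IsHist I (some γ, s) h → h.getLast? = some c →
    NashEq I c (restrictO I h oh) (restrictP I h σ)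

/-- The correctness assertion `I ⊨ {P} γ {Q}`. -/
def Valid (I : Interp Ag V F R) (P : EPred I) (γ : Mech Ag V F R) (Q : EPred I) : Prop :=
  ∀ so ∈ P, ∃ (oh : OutcomeF I) (σ : Profile I),
    memOhat I (some γ, so.1) Q oh ∧ SPE I γ so.1 oh σ ∧ oh (runOf I (some γ, so.1) σ) = so.2

/-- The weakest precondition `wpre(γ,Q,I)`. -/
def wpre (I : Interp Ag V F R) (γ : Mech Ag V F R) (Q : EPred I) : EPred I :=
  {so | ∃ (oh : OutcomeF I) (σ : Profile I),
    memOhat I (some γ, so.1) Q oh ∧ SPE I γ so.1 oh σ ∧ oh (runOf I (some γ, so.1) σ) = so.2}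

/-- The substituted e-predicate `Q[x/t]`. -/
def substPred (I : Interp Ag V F R) (Q : EPred I) (x : V) (t : Term V F) : EPred I :=
  {so | (updState I so.1 x (t.eval I so.1), so.2) ∈ Q}

/-- `B^I ∩ P`. -/
def gate (I : Interp Ag V F R) (B : BExp V F R) (P : EPred I) : EPred I :=
  {so | so ∈ P ∧ B.holds I so.1}

/-- `(¬B)^I ∩ P`. -/
def gateN (I : Interp Ag V F R) (B : BExp V F R) (P : EPred I) : EPred I :=
  {so | so ∈ P ∧ ¬ B.holds I so.1}

/-- The Hoare-style calculus for mechanisms: `I ⊢ {P} γ {Q}`. -/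
inductive Deriv (I : Interp Ag V F R) : EPred I → Mech Ag V F R → EPred I → Prop where
  | assign (Q : EPred I) (x : V) (t : Term V F) :
      Deriv I (substPred I Q x t) (.assign x t) Q
  | choice (A : Finset Ag) (hA : A.Nonempty) (X : Ag → V) (hX : Set.InjOn X ↑A)
      (Q : EPred I) :
      Deriv I (wpre I (.choice A hA X hX) Q) (.choice A hA X hX) Q
  | comp {P R' Q : EPred I} {γ1 γ2 : Mech Ag V F R} :
      Deriv I P γ1 R' → Deriv I R' γ2 Q → Deriv I P (.seq γ1 γ2) Q
  | ifR {P Q : EPred I} {B : BExp V F R} {γ1 γ2 : Mech Ag V F R} :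
      Deriv I (gate I B P) γ1 Q → Deriv I (gateN I B P) γ2 Q →
      Deriv I P (.ite B γ1 γ2) Q
  | whileR {P : EPred I} {B : BExp V F R} {γ : Mech Ag V F R} :
      Deriv I (gate I B P) γ P → Deriv I P (.wh B γ) (gateN I B P)
  | conseq {P P' Q Q' : EPred I} {γ : Mech Ag V F R} :
      P ⊆ P' → Deriv I P' γ Q' → Q' ⊆ Q → Deriv I P γ Q

/-- The Nash-equilibrium variant of validity. -/
def NashValid (I : Interp Ag V F R) (P : EPred I) (γ : Mech Ag V F R) (Q : EPred I) : Prop :=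
  ∀ so ∈ P, ∃ (oh : OutcomeF I) (σ : Profile I),
    memOhat I (some γ, so.1) Q oh ∧ NashEq I (some γ, so.1) oh σ ∧
    oh (runOf I (some γ, so.1) σ) = so.2

/-- Mechanisms without any `ch_A` construct, i.e. ordinary programs (MPL(PRG)). -/
def ChoiceFree : Mech Ag V F R → Prop
  | .assign _ _ => True
  | .seq γ1 γ2 => ChoiceFree γ1 ∧ ChoiceFree γ2
  | .ite _ γ1 γ2 => ChoiceFree γ1 ∧ ChoiceFree γ2
  | .wh _ γ => ChoiceFree γ
  | .choice _ _ _ _ => False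

/-- Standard Hoare partial correctness: every finite maximal execution of `γ`
from a state in `P` terminates in a state in `Q`. -/
def HoarePartial (I : Interp Ag V F R) (P : Set (State I)) (γ : Mech Ag V F R)
    (Q : Set (State I)) : Prop :=
  ∀ s ∈ P, ∀ (h : List (Cfg I)) (t : State I),
    IsHist I (some γ, s) h → h.getLast? = some ((none : Option (Mech Ag V F R)), t) → t ∈ Q

end MPL

namespace MPL

variable {Ag V F R : Type} {I : Interp Ag V F R}

/-- `Hist I c0 g c`: the list `g ++ [c]` is a history of the game rooted at `c0`. -/
inductive Hist (I : Interp Ag V F R) (c0 : Cfg I) : List (Cfg I) → Cfg I → Prop where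
  | root : Hist I c0 [] c0
  | snoc {g c L c'} : Hist I c0 g c → Step I c L c' → Hist I c0 (g ++ [c]) c'

theorem isHist_append_singleton_iff {c0 : Cfg I} (g : List (Cfg I)) (c : Cfg I) :
    IsHist I c0 (g ++ [c]) ↔ Hist I c0 g c := by
  constructor
  · induction g using List.reverseRecOn generalizing c with
    | nil =>
      rintro ⟨h, -⟩
      obtain rfl : c = c0 := by simpa using h
      exact .root
    | append_singleton g b ih =>
      rintro ⟨hhead, hchain⟩
      have hc := List.isChain_append.1 hchain
      obtain ⟨L, hL⟩ := hc.2.2 b (by simp) c (by simp)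
      refine .snoc (ih b ⟨?_, hc.1⟩) hL
      rw [← hhead]
      simp [List.head?_append]
  · intro h
    induction h with
    | root => exact ⟨rfl, List.isChain_singleton _⟩
    | @snoc g c L c' _ hs ih =>
      refine ⟨?_, List.isChain_append.2 ⟨ih.2, List.isChain_singleton _, ?_⟩⟩
      · rw [List.head?_append, ih.1]; rfl
      · intro x hx y hy
        simp at hx hy
        subst hx hy
        exact ⟨L, hs⟩

theorem Step.source_ne_none {c : Cfg I} {L : Set Ag} {c' : Cfg I} (h : Step I c L c') :
    c.1 ≠ none := by
  cases h <;> simp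

theorem Hist.ne_none_of_mem {c0 : Cfg I} {g : List (Cfg I)} {c : Cfg I} (h : Hist I c0 g c) :
    ∀ x ∈ g, x.1 ≠ none := by
  induction h with
  | root => simp
  | snoc _ hs ih =>
    intro x hx
    rcases List.mem_append.1 hx with hx | hx
    · exact ih x hx
    · rw [List.mem_singleton.1 hx]
      exact hs.source_ne_none

theorem Hist.head?_eq {c0 : Cfg I} {g : List (Cfg I)} {c : Cfg I} (h : Hist I c0 g c) :
    (g ++ [c]).head? = some c0 :=
  ((isHist_append_singleton_iff g c).2 h).1

theorem step_next (σ : Profile I) (h : List (Cfg I)) (γ : Mech Ag V F R) (s : State I) :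
    ∃ L, Step I (some γ, s) L (next I σ h γ s) := by
  induction γ generalizing s with
  | assign x t => exact ⟨_, .assign x t s⟩
  | seq γ1 γ2 ih1 ih2 =>
    obtain ⟨L, hL⟩ := ih1 s
    rw [next]
    split <;> rename_i heq <;> rw [heq] at hL
    · exact ⟨L, .seqFin hL⟩
    · exact ⟨L, .seqStep hL⟩
  | ite B γ1 γ2 =>
    rw [next]
    split
    · exact ⟨_, .iteT ‹_›⟩
    · exact ⟨_, .iteF ‹_›⟩
  | wh B γ =>
    rw [next]
    split
    · exact ⟨_, .whT ‹_›⟩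
    · exact ⟨_, .whF ‹_›⟩
  | choice A hA X hX =>
    refine ⟨_, .choice A hA X hX s _ fun y hy => ?_⟩
    have : ¬ ∃ a, a ∈ A ∧ X a = y := fun ⟨a, ha, e⟩ => hy a ha e
    simp [chooseVal, this]

/-- The successor depends only on the values the profiles choose at the given histories. -/
theorem next_congr {σ τ : Profile I} {h h' : List (Cfg I)} (e : ∀ a, σ a h = τ a h')
    (γ : Mech Ag V F R) (s : State I) : next I σ h γ s = next I τ h' γ s := by
  induction γ generalizing s with
  | seq γ1 γ2 ih1 ih2 => simp only [next, ih1]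
  | choice A hA X hX =>
    rw [next, next]
    congr 1
    funext y
    unfold chooseVal
    split
    · exact e _
    · rfl
  | _ => rfl

/-- Every transition is brought about by suitable choices of the agents. -/
theorem Step.exists_choices {c c' : Cfg I} {L : Set Ag} (hs : Step I c L c') :
    ∃ v : Ag → I.D, ∀ γ s, c = (some γ, s) → ∀ (σ : Profile I) h, (∀ a, σ a h = v a) →
      next I σ h γ s = c' := by
  induction hs with
  | assign x t s =>
    refine ⟨fun _ => I.worst, ?_⟩
    rintro _ _ ⟨⟩ σ h -
    rfl
  | choice A hA X hX s s' hagree =>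
    refine ⟨fun a => s' (X a), ?_⟩
    rintro _ _ ⟨⟩ σ h hv
    rw [next]
    congr 1
    funext y
    unfold chooseVal
    split
    · rename_i hy
      exact (hv _).trans (congrArg s' hy.choose_spec.2)
    · rename_i hy
      exact (hagree y fun a ha e => hy ⟨a, ha, e⟩).symm
  | seqFin _ ih =>
    obtain ⟨v, ih⟩ := ih
    refine ⟨v, ?_⟩
    rintro _ _ ⟨⟩ σ h hv
    simp only [next, ih _ _ rfl σ h hv]
  | seqStep _ ih =>
    obtain ⟨v, ih⟩ := ih
    refine ⟨v, ?_⟩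
    rintro _ _ ⟨⟩ σ h hv
    simp only [next, ih _ _ rfl σ h hv]
  | iteT hB =>
    refine ⟨fun _ => I.worst, ?_⟩
    rintro _ _ ⟨⟩ σ h -
    simp [next, hB]
  | iteF hB =>
    refine ⟨fun _ => I.worst, ?_⟩
    rintro _ _ ⟨⟩ σ h -
    simp [next, hB]
  | whF hB =>
    refine ⟨fun _ => I.worst, ?_⟩
    rintro _ _ ⟨⟩ σ h -
    simp [next, hB]
  | whT hB =>
    refine ⟨fun _ => I.worst, ?_⟩
    rintro _ _ ⟨⟩ σ h -
    simp [next, hB]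

/-! ### Playing on from a history -/

theorem extend_append_none (σ : Profile I) (g : List (Cfg I)) (s : State I) :
    extend I σ (g ++ [(none, s)]) = g ++ [(none, s)] := by
  simp [extend]

theorem extend_append_some (σ : Profile I) (g : List (Cfg I)) (γ : Mech Ag V F R) (s : State I) :
    extend I σ (g ++ [(some γ, s)]) =
      (g ++ [(some γ, s)]) ++ [next I σ (g ++ [(some γ, s)]) γ s] := by
  simp [extend]

theorem prefix_extend (σ : Profile I) (h : List (Cfg I)) : h <+: extend I σ h := by
  unfold extend
  split
  · exact List.prefix_append _ _
  · exact List.prefix_rfl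

theorem extend_append (σ : Profile I) (d h : List (Cfg I)) (hh : h ≠ []) :
    extend I σ (d ++ h) = d ++ extend I (fun a l => σ a (d ++ l)) h := by
  obtain ⟨g, ⟨_ | γ, s⟩, rfl⟩ := List.eq_nil_or_concat' h |>.resolve_left hh
  · rw [extend_append_none, ← List.append_assoc, extend_append_none]
  · rw [extend_append_some, ← List.append_assoc, extend_append_some,
      ← List.append_assoc,
      next_congr (σ := fun a l => σ a (d ++ l)) (τ := σ) (h' := d ++ g ++ [(some γ, s)])]
    · rw [List.append_assoc d g]
    · exact fun a => by rw [List.append_assoc]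

/-- The history reached from `h` after `n` more steps of play. -/
def playFrom (σ : Profile I) (h : List (Cfg I)) (n : ℕ) : List (Cfg I) :=
  (extend I σ)^[n] h

@[simp] theorem playFrom_zero (σ : Profile I) (h : List (Cfg I)) : playFrom σ h 0 = h := rfl

theorem playFrom_succ (σ : Profile I) (h : List (Cfg I)) (n : ℕ) :
    playFrom σ h (n + 1) = extend I σ (playFrom σ h n) :=
  Function.iterate_succ_apply' _ _ _

theorem playFrom_add (σ : Profile I) (h : List (Cfg I)) (m n : ℕ) :
    playFrom σ h (m + n) = playFrom σ (playFrom σ h m) n := by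
  rw [Nat.add_comm]
  exact Function.iterate_add_apply _ _ _ _

theorem runH_eq_playFrom (c0 : Cfg I) (σ : Profile I) (n : ℕ) :
    runH I c0 σ n = playFrom σ [c0] n := by
  induction n with
  | zero => rfl
  | succ n ih => rw [playFrom_succ, runH, ih]

theorem playFrom_prefix (σ : Profile I) (h : List (Cfg I)) {m n : ℕ} (hmn : m ≤ n) :
    playFrom σ h m <+: playFrom σ h n := by
  induction n, hmn using Nat.le_induction with
  | base => exact List.prefix_rfl
  | succ n _ ih => exact ih.trans (by rw [playFrom_succ]; exact prefix_extend _ _)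

theorem playFrom_ne_nil (σ : Profile I) {h : List (Cfg I)} (hh : h ≠ []) (n : ℕ) :
    playFrom σ h n ≠ [] :=
  (playFrom_prefix σ h n.zero_le).ne_nil hh

theorem playFrom_append (σ : Profile I) (d h : List (Cfg I)) (hh : h ≠ []) (n : ℕ) :
    playFrom σ (d ++ h) n = d ++ playFrom (fun a l => σ a (d ++ l)) h n := by
  induction n with
  | zero => rfl
  | succ n ih => rw [playFrom_succ, playFrom_succ, ih, extend_append _ _ _ (playFrom_ne_nil _ hh n)]

theorem playFrom_append_none (σ : Profile I) (g : List (Cfg I)) (s : State I) (n : ℕ) :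
    playFrom σ (g ++ [(none, s)]) n = g ++ [(none, s)] :=
  Function.iterate_fixed (extend_append_none σ g s) n

theorem lt_length_playFrom_or (σ : Profile I) {h : List (Cfg I)} (hh : h ≠ []) (n : ℕ) :
    n < (playFrom σ h n).length ∨ ∃ g s, playFrom σ h n = g ++ [(none, s)] := by
  induction n with
  | zero => exact .inl (List.length_pos_iff.2 hh)
  | succ n ih =>
    rcases ih with ih | ⟨g, s, e⟩
    · obtain ⟨g, ⟨_ | γ, s⟩, e⟩ := List.eq_nil_or_concat' (playFrom σ h n)
        |>.resolve_left (playFrom_ne_nil σ hh n)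
      · exact .inr ⟨g, s, by rw [playFrom_succ, e, extend_append_none]⟩
      · left
        rw [playFrom_succ, e, extend_append_some, ← e]
        simpa using ih
    · exact .inr ⟨g, s, by rw [playFrom_succ, e, extend_append_none]⟩

/-- The maximal run through the history `h` on which play after `h` follows `σ`. -/
def runFrom (σ : Profile I) (h : List (Cfg I)) : Run I :=
  fun n => (playFrom σ h n)[n]?

theorem runOf_eq_runFrom (c0 : Cfg I) (σ : Profile I) : runOf I c0 σ = runFrom σ [c0] := by
  funext n
  rw [runOf, runFrom, runH_eq_playFrom]

/-- A finite sequence of configurations as a run. -/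
def listRun (h : List (Cfg I)) : Run I := fun n => h[n]?

theorem listRun_injective : Function.Injective (listRun (I := I)) := fun _ _ e =>
  List.ext_getElem? fun n => congrFun e n

theorem runFrom_eq_some_iff (σ : Profile I) {h : List (Cfg I)} (hh : h ≠ []) (n : ℕ) (c : Cfg I) :
    runFrom σ h n = some c ↔ ∃ m, (playFrom σ h m)[n]? = some c := by
  refine ⟨fun e => ⟨n, e⟩, ?_⟩
  rintro ⟨m, e⟩
  have key : ∀ {l l' : List (Cfg I)}, l <+: l' → l[n]? = some c → l'[n]? = some c := by
    rintro l l' ⟨t, rfl⟩ e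
    obtain ⟨hn, -⟩ := List.getElem?_eq_some_iff.1 e
    rwa [List.getElem?_append_left hn]
  rcases le_total m n with hmn | hmn
  · exact key (playFrom_prefix σ h hmn) e
  · rcases lt_length_playFrom_or σ hh n with hn | ⟨g, s, eg⟩
    · obtain ⟨t, ht⟩ := playFrom_prefix σ h hmn
      rw [← ht, List.getElem?_append_left hn] at e
      exact e
    · obtain ⟨k, rfl⟩ := Nat.exists_eq_add_of_le hmn
      rw [playFrom_add, eg, playFrom_append_none, ← eg] at e
      exact e

theorem runFrom_playFrom (σ : Profile I) {h : List (Cfg I)} (hh : h ≠ []) (m : ℕ) :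
    runFrom σ (playFrom σ h m) = runFrom σ h := by
  funext n
  ext c
  rw [runFrom_eq_some_iff σ hh, runFrom_eq_some_iff σ (playFrom_ne_nil σ hh m)]
  constructor
  · rintro ⟨k, e⟩
    exact ⟨m + k, by rwa [playFrom_add]⟩
  · rintro ⟨k, e⟩
    refine ⟨k, ?_⟩
    rw [← playFrom_add]
    obtain ⟨t, ht⟩ := playFrom_prefix σ h (Nat.le_add_left k m)
    obtain ⟨hn, -⟩ := List.getElem?_eq_some_iff.1 e
    rwa [← ht, List.getElem?_append_left hn]

theorem runFrom_append_none (σ : Profile I) (g : List (Cfg I)) (s : State I) :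
    runFrom σ (g ++ [(none, s)]) = listRun (g ++ [(none, s)]) := by
  funext n
  rw [runFrom, playFrom_append_none, listRun]

theorem runFrom_append (σ : Profile I) (d h : List (Cfg I)) (hh : h ≠ []) :
    runFrom σ (d ++ h) = prependRun I d (runFrom (fun a l => σ a (d ++ l)) h) := by
  funext n
  ext c
  rw [runFrom_eq_some_iff σ (by simp [hh])]
  simp only [playFrom_append σ d h hh, prependRun]
  split
  · rename_i hn
    simp [List.getElem?_append_left hn, hn]
  · rename_i hn
    rw [runFrom_eq_some_iff _ hh]
    simp only [List.getElem?_append_right (not_lt.1 hn)]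

theorem listRun_append (d h : List (Cfg I)) : listRun (d ++ h) = prependRun I d (listRun h) := by
  funext n
  unfold listRun prependRun
  split
  · rename_i hn
    simp [List.getElem?_append_left hn, hn]
  · rename_i hn
    rw [List.getElem?_append_right (not_lt.1 hn)]

theorem Hist.exists_extend {c0 : Cfg I} {g : List (Cfg I)} {c : Cfg I} (h : Hist I c0 g c)
    (σ : Profile I) : ∃ g' c', extend I σ (g ++ [c]) = g' ++ [c'] ∧ Hist I c0 g' c' := by
  obtain ⟨_ | γ, s⟩ := c
  · exact ⟨g, _, extend_append_none σ g s, h⟩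
  · obtain ⟨L, hL⟩ := step_next σ (g ++ [(some γ, s)]) γ s
    exact ⟨_, _, extend_append_some σ g γ s, h.snoc hL⟩

theorem Hist.exists_playFrom {c0 : Cfg I} {g : List (Cfg I)} {c : Cfg I} (h : Hist I c0 g c)
    (σ : Profile I) (n : ℕ) :
    ∃ g' c', playFrom σ (g ++ [c]) n = g' ++ [c'] ∧ Hist I c0 g' c' := by
  induction n with
  | zero => exact ⟨g, c, rfl, h⟩
  | succ n ih =>
    obtain ⟨g', c', e, h'⟩ := ih
    rw [playFrom_succ, e]
    exact h'.exists_extend σ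

theorem Hist.runFrom_congr {c0 : Cfg I} {g : List (Cfg I)} {c : Cfg I} (h : Hist I c0 g c)
    {σ τ : Profile I}
    (e : ∀ a g γ s, Hist I c0 g (some γ, s) → σ a (g ++ [(some γ, s)]) = τ a (g ++ [(some γ, s)])) :
    runFrom σ (g ++ [c]) = runFrom τ (g ++ [c]) := by
  have key : ∀ n, playFrom σ (g ++ [c]) n = playFrom τ (g ++ [c]) n := by
    intro n
    induction n with
    | zero => rfl
    | succ n ih =>
      rw [playFrom_succ, playFrom_succ, ← ih]
      obtain ⟨g', ⟨_ | γ, s⟩, e', h'⟩ := h.exists_playFrom σ n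
      · rw [e', extend_append_none, extend_append_none]
      · rw [e', extend_append_some, extend_append_some,
          next_congr fun a => e a g' γ s h']
  funext n
  rw [runFrom, runFrom, key]

theorem length_playFrom_le (σ : Profile I) (h : List (Cfg I)) (n : ℕ) :
    (playFrom σ h n).length ≤ h.length + n := by
  induction n with
  | zero => simp
  | succ n ih =>
    rw [playFrom_succ, extend]
    split
    · rw [List.length_append, List.length_singleton]
      omega
    · omega

/-- Every history is played by some strategy profile. -/
theorem Hist.exists_profile {c0 : Cfg I} {g : List (Cfg I)} {c : Cfg I} (h : Hist I c0 g c) :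
    ∃ σ : Profile I, playFrom σ [c0] g.length = g ++ [c] := by
  induction h with
  | root => exact ⟨fun _ _ => I.worst, rfl⟩
  | @snoc g c L c' _ hs ih =>
    obtain ⟨σ, e⟩ := ih
    obtain ⟨v, hv⟩ := hs.exists_choices
    let τ : Profile I := fun a l => if l = g ++ [c] then v a else σ a l
    have key : ∀ n ≤ g.length, playFrom τ [c0] n = playFrom σ [c0] n := by
      intro n hn
      induction n with
      | zero => rfl
      | succ n ihn =>
        rw [playFrom_succ, playFrom_succ, ihn (by omega)]
        have hlen := length_playFrom_le σ [c0] n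
        obtain ⟨g', ⟨_ | γ, s⟩, e'⟩ := List.eq_nil_or_concat' (playFrom σ [c0] n)
          |>.resolve_left (playFrom_ne_nil σ (by simp) n)
        · rw [e', extend_append_none, extend_append_none]
        · rw [e', extend_append_some, extend_append_some, next_congr (τ := σ)]
          intro a
          refine if_neg fun h => ?_
          rw [e', h] at hlen
          simp at hlen
          omega
    refine ⟨τ, ?_⟩
    obtain ⟨_ | γ, s⟩ := c
    · exact absurd rfl hs.source_ne_none
    · rw [List.length_append, List.length_singleton, playFrom_succ, key _ le_rfl, e,
        extend_append_some, hv γ s rfl τ _ fun a => if_pos rfl]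

/-! ### Outcome functions and equilibria in terms of histories -/

/-- `ô ∈ Ô_Q` says that every maximal finite history has an outcome satisfying `Q`. -/
theorem memOhat_iff {c0 : Cfg I} {Q : EPred I} {oh : OutcomeF I} :
    memOhat I c0 Q oh ↔
      ∀ g s, Hist I c0 g (none, s) → (s, oh (listRun (g ++ [(none, s)]))) ∈ Q := by
  have run_eq : ∀ {σ : Profile I} {n g s}, playFrom σ [c0] n = g ++ [(none, s)] →
      runOf I c0 σ = listRun (g ++ [(none, s)]) := by
    intro σ n g s e
    rw [runOf_eq_runFrom, ← runFrom_playFrom σ (by simp) n, e, runFrom_append_none]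
  have final : ∀ {σ : Profile I} (ht : Terminates I c0 σ), ∃ n g,
      playFrom σ [c0] n = g ++ [(none, finalState I ht)] := by
    intro σ ht
    obtain ⟨g, e⟩ := List.getLast?_eq_some_iff.1 ht.choose_spec.choose_spec
    exact ⟨_, g, (runH_eq_playFrom _ _ _).symm.trans e⟩
  constructor
  · intro hm g s h
    obtain ⟨σ, e⟩ := h.exists_profile
    have ht : Terminates I c0 σ := ⟨g.length, s, by rw [runH_eq_playFrom, e]; simp⟩
    obtain ⟨n, g', e'⟩ := final ht
    have := listRun_injective ((run_eq e').symm.trans (run_eq e))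
    obtain ⟨-, hs⟩ : g' = g ∧ finalState I ht = s := by simpa using this
    have hQ := hm σ ht
    rwa [run_eq e, hs] at hQ
  · intro hm σ ht
    obtain ⟨n, g, e⟩ := final ht
    obtain ⟨g', c', e', hist⟩ := (Hist.root (c0 := c0)).exists_playFrom σ n
    obtain ⟨rfl, rfl⟩ : g' = g ∧ c' = (none, finalState I ht) := by
      simpa using e'.symm.trans e
    rw [run_eq e]
    exact hm _ _ hist

/-- `τ` agrees with `σ` on all strategies except possibly that of `i`, at all histories at which
a move is made in the game rooted at `c0`. -/
def AgreeOff (c0 : Cfg I) (i : Ag) (σ τ : Profile I) : Prop :=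
  ∀ j, j ≠ i → ∀ g γ s, Hist I c0 g (some γ, s) →
    τ j (g ++ [(some γ, s)]) = σ j (g ++ [(some γ, s)])

theorem restrictP_append_singleton (σ : Profile I) (g : List (Cfg I)) (c : Cfg I) :
    restrictP I (g ++ [c]) σ = fun a l => σ a (g ++ l) := by
  funext a l
  rw [restrictP, List.dropLast_concat]

/-- Subgame perfection says that no unilateral deviation pays off after any history. -/
theorem spe_iff {γ0 : Mech Ag V F R} {s0 : State I} {oh : OutcomeF I} {σ : Profile I} :
    SPE I γ0 s0 oh σ ↔ ∀ g c, Hist I (some γ0, s0) g c → ∀ i τ,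
      AgreeOff (some γ0, s0) i σ τ →
        I.pref i (oh (runFrom σ (g ++ [c]))) (oh (runFrom τ (g ++ [c]))) := by
  constructor
  · intro hσ g c h i τ hτ
    let τ' : Profile I := fun j => if j = i then τ j else σ j
    have e : runFrom τ (g ++ [c]) = runFrom τ' (g ++ [c]) := by
      refine h.runFrom_congr fun a g γ s h' => ?_
      by_cases ha : a = i
      · simp [τ', ha]
      · simp [τ', ha, hτ a ha g γ s h']
    have := hσ (g ++ [c]) c ((isHist_append_singleton_iff g c).2 h) (by simp) i
      (restrictP I (g ++ [c]) τ') (fun j hj => by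
        simp only [restrictP_append_singleton, τ', if_neg hj])
    simp only [restrictO, runOf_eq_runFrom, restrictP_append_singleton,
      List.dropLast_concat] at this
    rwa [e, runFrom_append _ _ _ (by simp), runFrom_append _ _ _ (by simp)]
  · intro hσ h c hh hc i τ hτ
    obtain ⟨g, rfl⟩ := List.getLast?_eq_some_iff.1 hc
    let τ' : Profile I := fun j l => if g <+: l then τ j (l.drop g.length) else σ j l
    have := hσ g c ((isHist_append_singleton_iff g c).1 hh) i τ' (by
      intro j hj g' γ s _
      simp only [τ']
      split
      · rename_i hp
        obtain ⟨t, ht⟩ := hp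
        rw [hτ j hj, ← ht]
        simp [restrictP_append_singleton]
      · rfl)
    rw [runFrom_append _ _ _ (by simp), runFrom_append _ _ _ (by simp)] at this
    simpa [restrictO, runOf_eq_runFrom, restrictP_append_singleton, τ'] using this

/-! ### Sequential composition -/

theorem Mech.seq_ne_right (γ γ2 : Mech Ag V F R) : Mech.seq γ γ2 ≠ γ2 := by
  intro h
  have := congrArg sizeOf h
  simp at this

/-- The configuration of `γ;γ2` that corresponds to a configuration of `γ`. -/
def Cfg.seqRight (γ2 : Mech Ag V F R) : Cfg I → Cfg I
  | (none, s) => (some γ2, s)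
  | (some γ, s) => (some (.seq γ γ2), s)

theorem Cfg.seqRight_injective (γ2 : Mech Ag V F R) :
    Function.Injective (Cfg.seqRight (I := I) γ2) := by
  rintro ⟨_ | γ, s⟩ ⟨_ | γ', s'⟩ h <;> simp only [Cfg.seqRight, Prod.mk.injEq] at h ⊢
  · exact ⟨trivial, h.2⟩
  · exact absurd (Option.some.inj h.1).symm (Mech.seq_ne_right _ _)
  · exact absurd (Option.some.inj h.1) (Mech.seq_ne_right _ _)
  · simpa using h

theorem next_seq (σ : Profile I) (h : List (Cfg I)) (γ γ2 : Mech Ag V F R) (s : State I) :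
    next I σ h (.seq γ γ2) s = Cfg.seqRight γ2 (next I σ h γ s) := by
  rw [next]
  rcases next I σ h γ s with ⟨_ | γ', s'⟩ <;> rfl

theorem Step.seq_inv {γ γ2 : Mech Ag V F R} {s : State I} {L : Set Ag} {c : Cfg I}
    (h : Step I (some (.seq γ γ2), s) L c) :
    ∃ c', Step I (some γ, s) L c' ∧ c = Cfg.seqRight γ2 c' := by
  cases h with
  | seqFin h => exact ⟨_, h, rfl⟩
  | seqStep h => exact ⟨_, h, rfl⟩

/-- A history of `γ1;γ2` either stays inside `γ1`, or consists of a maximal history of `γ1`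
followed by a history of `γ2`. -/
theorem Hist.seq_cases {γ1 γ2 : Mech Ag V F R} {s0 : State I} {g : List (Cfg I)} {c : Cfg I}
    (h : Hist I (some (.seq γ1 γ2), s0) g c) :
    (∃ g1 γ s, Hist I (some γ1, s0) g1 (some γ, s) ∧
      g = g1.map (Cfg.seqRight γ2) ∧ c = Cfg.seqRight γ2 (some γ, s)) ∨
    ∃ d s g2, Hist I (some γ1, s0) d (none, s) ∧ Hist I (some γ2, s) g2 c ∧
      g = d.map (Cfg.seqRight γ2) ++ g2 := by
  induction h with
  | root => exact .inl ⟨[], γ1, s0, .root, rfl, rfl⟩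
  | snoc _ hs ih =>
    rcases ih with ⟨g1, γ, s, h1, rfl, rfl⟩ | ⟨d, s, g2, hd, h2, rfl⟩
    · obtain ⟨⟨_ | γ', s'⟩, hs', rfl⟩ := hs.seq_inv
      · exact .inr ⟨g1 ++ [(some γ, s)], s', [], h1.snoc hs', .root, by simp⟩
      · exact .inl ⟨g1 ++ [(some γ, s)], γ', s', h1.snoc hs', by simp, rfl⟩
    · exact .inr ⟨d, s, _, hd, h2.snoc hs, by simp⟩

theorem Hist.map_seqRight {γ1 γ2 : Mech Ag V F R} {s0 : State I} {g : List (Cfg I)} {c : Cfg I}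
    (h : Hist I (some γ1, s0) g c) :
    Hist I (some (.seq γ1 γ2), s0) (g.map (Cfg.seqRight γ2)) (Cfg.seqRight γ2 c) := by
  induction h with
  | root => exact .root
  | snoc _ hs ih =>
    rename_i c L c' _
    obtain ⟨_ | γ, s⟩ := c
    · exact absurd rfl hs.source_ne_none
    · rw [List.map_append]
      obtain ⟨_ | γ', s'⟩ := c'
      · exact ih.snoc (.seqFin hs)
      · exact ih.snoc (.seqStep hs)

theorem Hist.append_seqRight {γ1 γ2 : Mech Ag V F R} {s0 s : State I} {d g : List (Cfg I)}
    {c : Cfg I} (hd : Hist I (some γ1, s0) d (none, s)) (h : Hist I (some γ2, s) g c) :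
    Hist I (some (.seq γ1 γ2), s0) (d.map (Cfg.seqRight γ2) ++ g) c := by
  induction h with
  | root => rw [List.append_nil]; exact hd.map_seqRight
  | snoc _ hs ih =>
    rw [← List.append_assoc]
    exact ih.snoc hs

theorem extend_map_seqRight (γ2 : Mech Ag V F R) (τ : Profile I) (g : List (Cfg I))
    (γ : Mech Ag V F R) (s : State I) :
    extend I τ ((g ++ [(some γ, s)]).map (Cfg.seqRight γ2)) =
      (extend I (fun a l => τ a (l.map (Cfg.seqRight γ2))) (g ++ [(some γ, s)])).map
        (Cfg.seqRight γ2) := by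
  rw [extend_append_some, List.map_append, List.map_append]
  simp only [List.map_singleton, Cfg.seqRight]
  rw [extend_append_some, next_seq]
  have e : next I (fun a l => τ a (l.map (Cfg.seqRight γ2))) (g ++ [(some γ, s)]) γ s =
      next I τ (g.map (Cfg.seqRight γ2) ++ [(some (.seq γ γ2), s)]) γ s :=
    next_congr (fun a => by simp [Cfg.seqRight]) γ s
  rw [e, List.map_append]
  rfl

/-- As long as `γ1` is being executed, a play of `γ1;γ2` mirrors a play of `γ1`. -/
theorem playFrom_map_seqRight (γ2 : Mech Ag V F R) (τ : Profile I) {h : List (Cfg I)} (hh : h ≠ [])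
    (n : ℕ) (hn : ∀ k < n, ∀ g s, playFrom (fun a l => τ a (l.map (Cfg.seqRight γ2))) h k ≠
      g ++ [(none, s)]) :
    playFrom τ (h.map (Cfg.seqRight γ2)) n =
      (playFrom (fun a l => τ a (l.map (Cfg.seqRight γ2))) h n).map (Cfg.seqRight γ2) := by
  induction n with
  | zero => rfl
  | succ n ih =>
    rw [playFrom_succ, playFrom_succ, ih fun k hk => hn k (by omega)]
    obtain ⟨g, ⟨_ | γ, s⟩, e⟩ := List.eq_nil_or_concat' _ |>.resolve_left
      (playFrom_ne_nil (fun a l => τ a (l.map (Cfg.seqRight γ2))) hh n)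
    · exact absurd e (hn n (by omega) g s)
    · rw [e, extend_map_seqRight]

theorem runFrom_map_seqRight_cases (γ2 : Mech Ag V F R) (τ : Profile I) {c0 : Cfg I}
    {g : List (Cfg I)} {c : Cfg I} (h : Hist I c0 g c) :
    ((∀ n x, runFrom (fun a l => τ a (l.map (Cfg.seqRight γ2))) (g ++ [c]) n = some x →
        x.1 ≠ none) ∧
      runFrom τ ((g ++ [c]).map (Cfg.seqRight γ2)) = fun n =>
        (runFrom (fun a l => τ a (l.map (Cfg.seqRight γ2))) (g ++ [c]) n).map (Cfg.seqRight γ2)) ∨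
    ∃ d s, Hist I c0 d (none, s) ∧
      runFrom (fun a l => τ a (l.map (Cfg.seqRight γ2))) (g ++ [c]) = listRun (d ++ [(none, s)]) ∧
      runFrom τ ((g ++ [c]).map (Cfg.seqRight γ2)) = prependRun I (d.map (Cfg.seqRight γ2))
        (runFrom (fun a l => τ a (d.map (Cfg.seqRight γ2) ++ l)) [(some γ2, s)]) := by
  set τ1 : Profile I := fun a l => τ a (l.map (Cfg.seqRight γ2)) with hτ1
  have hne : g ++ [c] ≠ [] := by simp
  by_cases hterm : ∃ m g' s, playFrom τ1 (g ++ [c]) m = g' ++ [(none, s)]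
  · right
    obtain ⟨d, s, e⟩ := Nat.find_spec hterm
    obtain ⟨d', x, e', hd⟩ := h.exists_playFrom τ1 (Nat.find hterm)
    obtain ⟨rfl, rfl⟩ : d' = d ∧ x = (none, s) := by simpa using e'.symm.trans e
    have hsim := playFrom_map_seqRight γ2 τ hne (Nat.find hterm) fun k hk g' s' e' =>
      Nat.find_min hterm hk ⟨g', s', e'⟩
    refine ⟨d', s, hd, ?_, ?_⟩
    · rw [← runFrom_playFrom τ1 hne (Nat.find hterm), e, runFrom_append_none]
    · rw [← runFrom_playFrom τ (by simp) (Nat.find hterm), hsim, ← hτ1, e, List.map_append,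
        runFrom_append _ _ _ (by simp)]
      rfl
  · left
    push Not at hterm
    constructor
    · intro n x hx
      obtain ⟨g', c', e', h'⟩ := h.exists_playFrom τ1 n
      rw [runFrom, e'] at hx
      rcases List.mem_append.1 (List.mem_of_getElem? hx) with hmem | hmem
      · exact h'.ne_none_of_mem x hmem
      · obtain rfl := List.mem_singleton.1 hmem
        obtain ⟨_ | γ, s⟩ := x
        · exact absurd e' (hterm n g' s)
        · simp
    · funext n
      rw [runFrom, playFrom_map_seqRight γ2 τ hne n fun k _ => hterm k, List.getElem?_map]
      rfl

theorem prependRun_length_add (l : List (Cfg I)) (ρ : Run I) (n : ℕ) :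
    prependRun I l ρ (l.length + n) = ρ n := by
  simp [prependRun]

/-- `p = (d, s, ρ')` splits the run `ρ` of `γ1;γ2` into the part `d` inside `γ1` and the part `ρ'`
inside `γ2`, which starts at the state `s`. -/
def IsSeqSplit (γ2 : Mech Ag V F R) (ρ : Run I) (p : List (Cfg I) × State I × Run I) : Prop :=
  (∀ c ∈ p.1, c.1 ≠ none) ∧ ρ = prependRun I (p.1.map (Cfg.seqRight γ2)) p.2.2 ∧
    p.2.2 0 = some (some γ2, p.2.1)

theorem IsSeqSplit.apply_length {γ2 : Mech Ag V F R} {ρ : Run I}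
    {p : List (Cfg I) × State I × Run I} (h : IsSeqSplit γ2 ρ p) :
    ρ p.1.length = some (Cfg.seqRight γ2 (none, p.2.1)) := by
  have := prependRun_length_add (p.1.map (Cfg.seqRight γ2)) p.2.2 0
  rwa [← h.2.1, h.2.2, List.length_map] at this

theorem IsSeqSplit.apply_of_lt {γ2 : Mech Ag V F R} {ρ : Run I}
    {p : List (Cfg I) × State I × Run I} (h : IsSeqSplit γ2 ρ p) {n : ℕ} (hn : n < p.1.length) :
    ρ n = some (Cfg.seqRight γ2 p.1[n]) := by
  rw [h.2.1]
  simp [prependRun, hn]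

theorem IsSeqSplit.length_le {γ2 : Mech Ag V F R} {ρ : Run I}
    {p q : List (Cfg I) × State I × Run I} (hp : IsSeqSplit γ2 ρ p) (hq : IsSeqSplit γ2 ρ q) :
    p.1.length ≤ q.1.length := by
  by_contra! hlt
  have := hp.apply_of_lt hlt
  rw [hq.apply_length] at this
  have := Cfg.seqRight_injective γ2 (Option.some.inj this)
  exact hp.1 _ (List.getElem_mem hlt) (by rw [← this])

theorem IsSeqSplit.unique {γ2 : Mech Ag V F R} {ρ : Run I}
    {p q : List (Cfg I) × State I × Run I} (hp : IsSeqSplit γ2 ρ p) (hq : IsSeqSplit γ2 ρ q) :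
    p = q := by
  have hlen := (hp.length_le hq).antisymm (hq.length_le hp)
  have h1 : p.1 = q.1 := List.ext_getElem hlen fun n h h' =>
    Cfg.seqRight_injective γ2 (Option.some.inj ((hp.apply_of_lt h).symm.trans (hq.apply_of_lt h')))
  have h2 : p.2.2 = q.2.2 := by
    funext n
    rw [← prependRun_length_add (p.1.map (Cfg.seqRight γ2)) p.2.2 n,
      ← prependRun_length_add (q.1.map (Cfg.seqRight γ2)) q.2.2 n, ← hp.2.1, ← hq.2.1]
    simp [hlen]
  have h3 : p.2.1 = q.2.1 := by
    have := hp.2.2.symm.trans (h2 ▸ hq.2.2)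
    simpa using this
  exact Prod.ext h1 (Prod.ext h3 h2)

theorem not_isSeqSplit_map {γ2 : Mech Ag V F R} {ρ : Run I} (hρ : ∀ n c, ρ n = some c → c.1 ≠ none)
    (p : List (Cfg I) × State I × Run I) :
    ¬ IsSeqSplit γ2 (fun n => (ρ n).map (Cfg.seqRight γ2)) p := by
  intro h
  obtain ⟨c, hc, e⟩ := Option.map_eq_some_iff.1 h.apply_length
  exact hρ _ c hc (by rw [Cfg.seqRight_injective γ2 e])

instance : Nonempty (Cfg I) := ⟨(none, fun _ => I.worst)⟩

/-- Evaluate runs inside `γ1` by `oh1`, and runs entering `γ2` by the outcome function chosen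
for the execution of `γ1`. -/
def seqOutcome (γ2 : Mech Ag V F R) (oh1 : OutcomeF I) (oh2 : List (Cfg I) → State I → OutcomeF I) :
    OutcomeF I := fun ρ =>
  if h : ∃ p, IsSeqSplit γ2 ρ p then oh2 h.choose.1 h.choose.2.1 h.choose.2.2
  else oh1 fun n => (ρ n).map (Function.invFun (Cfg.seqRight γ2))

theorem seqOutcome_prependRun {γ2 : Mech Ag V F R} (oh1 : OutcomeF I)
    (oh2 : List (Cfg I) → State I → OutcomeF I) {d : List (Cfg I)} {s : State I} {ρ : Run I}
    (hd : ∀ c ∈ d, c.1 ≠ none) (hρ : ρ 0 = some (some γ2, s)) :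
    seqOutcome γ2 oh1 oh2 (prependRun I (d.map (Cfg.seqRight γ2)) ρ) = oh2 d s ρ := by
  have hs : IsSeqSplit γ2 (prependRun I (d.map (Cfg.seqRight γ2)) ρ) (d, s, ρ) := ⟨hd, rfl, hρ⟩
  have h : ∃ p, IsSeqSplit γ2 (prependRun I (d.map (Cfg.seqRight γ2)) ρ) p := ⟨_, hs⟩
  rw [seqOutcome, dif_pos h, h.choose_spec.unique hs]

theorem seqOutcome_map {γ2 : Mech Ag V F R} (oh1 : OutcomeF I)
    (oh2 : List (Cfg I) → State I → OutcomeF I) {ρ : Run I}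
    (hρ : ∀ n c, ρ n = some c → c.1 ≠ none) :
    seqOutcome γ2 oh1 oh2 (fun n => (ρ n).map (Cfg.seqRight γ2)) = oh1 ρ := by
  rw [seqOutcome, dif_neg (not_exists.2 (not_isSeqSplit_map hρ))]
  simp [Option.map_map, Function.invFun_comp (Cfg.seqRight_injective γ2)]

/-- Play `σ1` inside `γ1`, and in `γ2` the profile chosen for the execution of `γ1`. -/
def seqProfile (γ2 : Mech Ag V F R) (σ1 : Profile I) (σ2 : List (Cfg I) → State I → Profile I) :
    Profile I := fun a l =>
  if h : ∃ p, IsSeqSplit γ2 (listRun l) p then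
    σ2 h.choose.1 h.choose.2.1 a (l.drop h.choose.1.length)
  else σ1 a (l.map (Function.invFun (Cfg.seqRight γ2)))

theorem seqProfile_append {γ2 : Mech Ag V F R} (σ1 : Profile I)
    (σ2 : List (Cfg I) → State I → Profile I) {d l : List (Cfg I)} {s : State I}
    (hd : ∀ c ∈ d, c.1 ≠ none) (hl : l.head? = some (some γ2, s)) (a : Ag) :
    seqProfile γ2 σ1 σ2 a (d.map (Cfg.seqRight γ2) ++ l) = σ2 d s a l := by
  have hs : IsSeqSplit γ2 (listRun (d.map (Cfg.seqRight γ2) ++ l)) (d, s, listRun l) :=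
    ⟨hd, listRun_append _ _, by rw [← hl, List.head?_eq_getElem?]; rfl⟩
  have h : ∃ p, IsSeqSplit γ2 (listRun (d.map (Cfg.seqRight γ2) ++ l)) p := ⟨_, hs⟩
  rw [seqProfile, dif_pos h, h.choose_spec.unique hs]
  simp

theorem seqProfile_map {γ2 : Mech Ag V F R} (σ1 : Profile I)
    (σ2 : List (Cfg I) → State I → Profile I) {l : List (Cfg I)} (hl : ∀ c ∈ l, c.1 ≠ none)
    (a : Ag) : seqProfile γ2 σ1 σ2 a (l.map (Cfg.seqRight γ2)) = σ1 a l := by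
  have e : listRun (l.map (Cfg.seqRight γ2)) = fun n => (listRun l n).map (Cfg.seqRight γ2) := by
    funext n
    exact List.getElem?_map ..
  have h : ¬ ∃ p, IsSeqSplit γ2 (listRun (l.map (Cfg.seqRight γ2))) p := by
    rw [e]
    exact not_exists.2 (not_isSeqSplit_map fun n c hc => hl c (List.mem_of_getElem? hc))
  rw [seqProfile, dif_neg h]
  simp [Function.invFun_comp (Cfg.seqRight_injective γ2)]

theorem Hist.runFrom_apply_zero {c0 : Cfg I} {g : List (Cfg I)} {c : Cfg I} (h : Hist I c0 g c)
    (σ : Profile I) : runFrom σ (g ++ [c]) 0 = some c0 := by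
  rw [runFrom, playFrom_zero, ← List.head?_eq_getElem?, h.head?_eq]

end MPL


open MPL in
/-- Composition Lemma: if `I ⊨ {P}γ1{R}` and `I ⊨ {R}γ2{Q}` then `I ⊨ {P}γ1;γ2{Q}`. -/
theorem composition_lemma {Ag V F R : Type} (I : Interp Ag V F R)
    (γ1 γ2 : Mech Ag V F R) (P R' Q : EPred I)
    (h1 : Valid I P γ1 R') (h2 : Valid I R' γ2 Q) :
    Valid I P (Mech.seq γ1 γ2) Q := by
  rintro ⟨s0, o⟩ hP
  obtain ⟨oh1, σ1, hoh1, hσ1, ho⟩ := h1 _ hP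
  rw [memOhat_iff] at hoh1
  rw [spe_iff] at hσ1
  dsimp only at hoh1 hσ1 ho ⊢
  have hex : ∀ d s, ∃ (oh : OutcomeF I) (σ : Profile I), Hist I (some γ1, s0) d (none, s) →
      memOhat I (some γ2, s) Q oh ∧ SPE I γ2 s oh σ ∧
        oh (runOf I (some γ2, s) σ) = oh1 (listRun (d ++ [(none, s)])) := by
    intro d s
    by_cases h : Hist I (some γ1, s0) d (none, s)
    · obtain ⟨oh, σ, H⟩ := h2 _ (hoh1 d s h)
      exact ⟨oh, σ, fun _ => H⟩
    · exact ⟨fun _ => I.worst, fun _ _ => I.worst, fun h' => absurd h' h⟩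
  choose oh2 σ2 H using hex
  set K : Cfg I → Cfg I := Cfg.seqRight γ2 with hK
  set oh := seqOutcome γ2 oh1 oh2 with hoh
  set σ := seqProfile γ2 σ1 σ2 with hσ
  have outcome_right : ∀ {d s g c}, Hist I (some γ1, s0) d (none, s) → Hist I (some γ2, s) g c →
      ∀ τ : Profile I, oh (runFrom τ (d.map K ++ (g ++ [c]))) =
        oh2 d s (runFrom (fun a l => τ a (d.map K ++ l)) (g ++ [c])) := by
    intro d s g c hd hg τ
    rw [runFrom_append _ _ _ (by simp)]
    exact seqOutcome_prependRun oh1 oh2 hd.ne_none_of_mem (hg.runFrom_apply_zero _)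
  have σ_right : ∀ {d s g c}, Hist I (some γ1, s0) d (none, s) → Hist I (some γ2, s) g c →
      ∀ a, σ a (d.map K ++ (g ++ [c])) = σ2 d s a (g ++ [c]) := fun hd hg a =>
    seqProfile_append σ1 σ2 hd.ne_none_of_mem hg.head?_eq a
  have σ_left : ∀ {g γ s}, Hist I (some γ1, s0) g (some γ, s) →
      ∀ a, σ a ((g ++ [(some γ, s)]).map K) = σ1 a (g ++ [(some γ, s)]) := by
    intro g γ s hg a
    refine seqProfile_map σ1 σ2 (fun c hc => ?_) a
    rcases List.mem_append.1 hc with hc | hc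
    · exact hg.ne_none_of_mem c hc
    · rw [List.mem_singleton.1 hc]; simp
  have eq_right : ∀ {d s g c}, Hist I (some γ1, s0) d (none, s) → Hist I (some γ2, s) g c →
      oh (runFrom σ (d.map K ++ (g ++ [c]))) = oh2 d s (runFrom (σ2 d s) (g ++ [c])) := by
    intro d s g c hd hg
    rw [outcome_right hd hg]
    exact congrArg _ (hg.runFrom_congr fun a g γ s hg => σ_right hd hg a)
  have le_right : ∀ {d s g c}, Hist I (some γ1, s0) d (none, s) → Hist I (some γ2, s) g c →
      ∀ i τ, AgreeOff (some (.seq γ1 γ2), s0) i σ τ →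
        I.pref i (oh2 d s (runFrom (σ2 d s) (g ++ [c])))
          (oh (runFrom τ (d.map K ++ (g ++ [c])))) := by
    intro d s g c hd hg i τ hτ
    rw [outcome_right hd hg]
    refine spe_iff.1 (H d s hd).2.1 g c hg i _ fun j hj g γ s' hg => ?_
    rw [← σ_right hd hg, ← List.append_assoc]
    exact hτ j hj _ γ s' (hd.append_seqRight hg)
  have root_right : ∀ {d s}, Hist I (some γ1, s0) d (none, s) →
      oh2 d s (runFrom (σ2 d s) ([] ++ [(some γ2, s)])) = oh1 (listRun (d ++ [(none, s)])) := by
    intro d s hd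
    rw [List.nil_append, ← runOf_eq_runFrom]
    exact (H d s hd).2.2
  have cases_left : ∀ {g c}, Hist I (some γ1, s0) g c → ∀ τ : Profile I,
      oh (runFrom τ ((g ++ [c]).map K)) = oh1 (runFrom (fun a l => τ a (l.map K)) (g ++ [c])) ∨
      ∃ d s, Hist I (some γ1, s0) d (none, s) ∧
        oh1 (runFrom (fun a l => τ a (l.map K)) (g ++ [c])) =
          oh2 d s (runFrom (σ2 d s) ([] ++ [(some γ2, s)])) ∧
        oh (runFrom τ ((g ++ [c]).map K)) =
          oh (runFrom τ (d.map K ++ ([] ++ [(some γ2, s)]))) := by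
    intro g c hg τ
    rcases runFrom_map_seqRight_cases γ2 τ hg with ⟨hn, e⟩ | ⟨d, s, hd, e1, e⟩
    · left
      rw [e]
      exact seqOutcome_map oh1 oh2 hn
    · refine .inr ⟨d, s, hd, ?_, ?_⟩
      · rw [root_right hd, e1]
      · rw [e, runFrom_append _ _ _ (by simp)]
        rfl
  have eq_left : ∀ {g c}, Hist I (some γ1, s0) g c →
      oh (runFrom σ ((g ++ [c]).map K)) = oh1 (runFrom σ1 (g ++ [c])) := by
    intro g c hg
    have e : runFrom (fun a l => σ a (l.map K)) (g ++ [c]) = runFrom σ1 (g ++ [c]) :=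
      hg.runFrom_congr fun a g γ s hg => σ_left hg a
    rw [← e]
    rcases cases_left hg σ with e | ⟨d, s, hd, e1, e⟩
    · exact e
    · rw [e, e1, eq_right hd .root]
  have le_left : ∀ {g c}, Hist I (some γ1, s0) g c →
      ∀ i τ, AgreeOff (some (.seq γ1 γ2), s0) i σ τ →
        I.pref i (oh1 (runFrom (fun a l => τ a (l.map K)) (g ++ [c])))
          (oh (runFrom τ ((g ++ [c]).map K))) := by
    intro g c hg i τ hτ
    rcases cases_left hg τ with e | ⟨d, s, hd, e1, e⟩
    · rw [e]
      exact I.pref_refl _ _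
    · rw [e, e1]
      exact le_right hd .root i τ hτ
  refine ⟨oh, σ, memOhat_iff.2 fun g s hg => ?_, spe_iff.2 fun g c hg i τ hτ => ?_, ?_⟩
  · rcases hg.seq_cases with ⟨g1, γ, s', -, -, e⟩ | ⟨d, s', g2, hd, hg2, rfl⟩
    · simp [Cfg.seqRight] at e
    · have e := seqOutcome_prependRun (γ2 := γ2) oh1 oh2 (ρ := listRun (g2 ++ [(none, s)]))
        hd.ne_none_of_mem (by rw [← hg2.head?_eq, List.head?_eq_getElem?]; rfl)
      rw [List.append_assoc, listRun_append, hoh, e]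
      exact memOhat_iff.1 (H d s' hd).1 g2 s hg2
  · rcases hg.seq_cases with ⟨g1, γ, s', hg1, rfl, rfl⟩ | ⟨d, s', g2, hd, hg2, rfl⟩
    · have e : g1.map K ++ [K (some γ, s')] = (g1 ++ [(some γ, s')]).map K := by simp
      rw [e, eq_left hg1]
      refine I.pref_trans _ _ _ _ (hσ1 g1 _ hg1 i _ ?_) (le_left hg1 i τ hτ)
      intro j hj g γ s hg
      rw [← σ_left hg]
      simpa [hK, Cfg.seqRight] using hτ j hj _ _ _ hg.map_seqRight
    · rw [List.append_assoc, eq_right hd hg2]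
      exact le_right hd hg2 i τ hτ
  · rw [runOf_eq_runFrom] at ho ⊢
    rw [← ho]
    exact eq_left .root
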